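/- Let f : 𝔹ⁿ → 𝔹ᵐ be minimal holomorphic with f(0) = 0, and for N > m define g = 0 ⊕ f : 𝔹ⁿ → 𝔹ᴺ by g(z) = (0, f(z)). Then Γ_f = Γ_g. -/

import Mathlib

noncomputable section
open Metric Set

/-- An automorphism of the unit ball of `EuclideanSpace ℂ ι`: a holomorphic self-map of the
ball with a holomorphic inverse. -/
def IsBallAut {ι : Type} [Fintype ι] (ψ : EuclideanSpace ℂ ι → EuclideanSpace ℂ ι) : Prop :=
  DifferentiableOn ℂ ψ (ball (0 : EuclideanSpace ℂ ι) 1) ∧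
    MapsTo ψ (ball (0 : EuclideanSpace ℂ ι) 1) (ball (0 : EuclideanSpace ℂ ι) 1) ∧
    ∃ φ : EuclideanSpace ℂ ι → EuclideanSpace ℂ ι,
      DifferentiableOn ℂ φ (ball (0 : EuclideanSpace ℂ ι) 1) ∧
      MapsTo φ (ball (0 : EuclideanSpace ℂ ι) 1) (ball (0 : EuclideanSpace ℂ ι) 1) ∧
      (∀ z ∈ ball (0 : EuclideanSpace ℂ ι) 1, φ (ψ z) = z) ∧
      (∀ z ∈ ball (0 : EuclideanSpace ℂ ι) 1, ψ (φ z) = z)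

/-- The radius factor `√(1 - ‖a‖²)`. -/
def mobS {E : Type*} [NormedAddCommGroup E] (a : E) : ℝ := Real.sqrt (1 - ‖a‖ ^ 2)

/-- Numerator of the ball involution. -/
def mobNum {E : Type*} [NormedAddCommGroup E] [InnerProductSpace ℂ E] (a z : E) : E :=
  (1 - inner ℂ a z / (1 + (mobS a : ℂ))) • a - (mobS a : ℂ) • z

/-- The ball involution exchanging `0` and `a`. -/
def mob {E : Type*} [NormedAddCommGroup E] [InnerProductSpace ℂ E] (a z : E) : E :=
  (1 - inner ℂ a z)⁻¹ • mobNum a z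

section mobius
variable {E : Type*} [NormedAddCommGroup E] [InnerProductSpace ℂ E]

lemma mobS_sq {a : E} (ha : ‖a‖ < 1) : mobS a ^ 2 = 1 - ‖a‖ ^ 2 := by
  unfold mobS
  rw [Real.sq_sqrt]
  nlinarith [norm_nonneg a]

lemma mobS_pos {a : E} (ha : ‖a‖ < 1) : 0 < mobS a := by
  unfold mobS
  apply Real.sqrt_pos.2
  nlinarith [norm_nonneg a]

lemma one_sub_inner_ne {a z : E} (ha : ‖a‖ < 1) (hz : ‖z‖ < 1) : 1 - inner ℂ a z ≠ 0 := by
  intro h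
  have h1 : inner ℂ a z = 1 := (sub_eq_zero.1 h).symm
  have h2 := norm_inner_le_norm (𝕜 := ℂ) a z
  rw [h1, norm_one] at h2
  nlinarith [norm_nonneg a, norm_nonneg z]

lemma one_add_mobS_ne {a : E} (ha : ‖a‖ < 1) : (1 + (mobS a : ℂ)) ≠ 0 := by
  have := mobS_pos ha
  have h : (1 + mobS a : ℝ) ≠ 0 := by positivity
  exact_mod_cast h

lemma mobS_ne {a : E} (ha : ‖a‖ < 1) : (mobS a : ℂ) ≠ 0 := by
  exact_mod_cast (mobS_pos ha).ne'

lemma inner_self_mob {a : E} (ha : ‖a‖ < 1) : inner ℂ a a = 1 - (mobS a : ℂ) ^ 2 := by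
  rw [inner_self_eq_norm_sq_to_K]
  have h := mobS_sq ha
  have h2 : ‖a‖ ^ 2 = 1 - mobS a ^ 2 := by linarith
  have : ((‖a‖ ^ 2 : ℝ) : ℂ) = ((1 - mobS a ^ 2 : ℝ) : ℂ) := by rw [h2]
  push_cast at this
  exact this

lemma mobNum_norm {a z : E} (ha : ‖a‖ < 1) :
    ‖mobNum a z‖ ^ 2 = ‖1 - inner ℂ a z‖ ^ 2 - mobS a ^ 2 * (1 - ‖z‖ ^ 2) := by
  have hs := mobS_pos ha
  have h2 := mobS_sq ha
  unfold mobNum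
  rw [norm_sub_sq (𝕜 := ℂ), inner_smul_left, inner_smul_right, norm_smul, norm_smul, mul_pow,
    mul_pow]
  generalize inner ℂ a z = t
  have ha2 : ‖a‖ ^ 2 = 1 - mobS a ^ 2 := by linarith
  rw [ha2]
  generalize mobS a = s at *
  have e : (1 - t / (1 + (s : ℂ))) = ⟨1 - t.re / (1 + s), - (t.im / (1 + s))⟩ := by
    have : (1 + (s : ℂ)) = ((1 + s : ℝ) : ℂ) := by push_cast; rfl
    rw [this]
    apply Complex.ext
    · rw [Complex.sub_re, Complex.div_ofReal_re, Complex.one_re]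
    · rw [Complex.sub_im, Complex.div_ofReal_im, Complex.one_im, zero_sub]
  rw [e, ← Complex.normSq_eq_norm_sq, ← Complex.normSq_eq_norm_sq, ← Complex.normSq_eq_norm_sq]
  have h1 : 1 + s ≠ 0 := by positivity
  simp [Complex.normSq_apply]
  field_simp
  ring

lemma mob_mem {a z : E} (ha : ‖a‖ < 1) (hz : ‖z‖ < 1) : ‖mob a z‖ < 1 := by
  have h := mobNum_norm (z := z) ha
  have hn : 0 < ‖1 - inner ℂ a z‖ := norm_pos_iff.2 (one_sub_inner_ne ha hz)
  unfold mob
  rw [norm_smul, norm_inv, inv_mul_lt_iff₀ hn, mul_one]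
  have : 0 < mobS a ^ 2 * (1 - ‖z‖ ^ 2) := by
    have := mobS_pos ha
    apply mul_pos (by positivity)
    nlinarith [norm_nonneg z]
  apply lt_of_pow_lt_pow_left₀ 2 hn.le
  linarith

lemma inner_mob {a z : E} (ha : ‖a‖ < 1) :
    inner ℂ a (mob a z) = (1 - inner ℂ a z)⁻¹ * (1 - (mobS a : ℂ) ^ 2 - inner ℂ a z) := by
  unfold mob mobNum
  have h1 := one_add_mobS_ne ha
  rw [inner_smul_right, inner_sub_right, inner_smul_right, inner_smul_right, inner_self_mob ha]
  congr 1
  field_simp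
  ring

lemma mob_mob {a z : E} (ha : ‖a‖ < 1) (hz : ‖z‖ < 1) : mob a (mob a z) = z := by
  have h1 := one_add_mobS_ne ha
  have h2 := one_sub_inner_ne ha hz
  have h3 := mobS_ne ha
  have h4 : 1 - inner ℂ a (mob a z) = (mobS a : ℂ) ^ 2 / (1 - inner ℂ a z) := by
    rw [inner_mob ha]
    field_simp
    ring
  have h5 : inner ℂ a (mob a z) = 1 - (mobS a : ℂ) ^ 2 / (1 - inner ℂ a z) := by
    rw [← h4]; ring
  rw [mob, mobNum, h5]
  rw [mob, mobNum]
  generalize inner ℂ a z = t at *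
  generalize (mobS a : ℂ) = s at *
  match_scalars
  · field_simp
    ring
  · field_simp
    ring

lemma mob_zero (a : E) : mob a 0 = a := by
  simp [mob, mobNum]

lemma mob_diff {a : E} (ha : ‖a‖ < 1) : DifferentiableOn ℂ (mob a) (ball (0 : E) 1) := by
  have hi : Differentiable ℂ (fun z : E => inner ℂ a z) := (innerSL ℂ a).differentiable
  intro z hz
  have hz' : ‖z‖ < 1 := by simpa using hz
  have hn := one_sub_inner_ne ha hz'
  apply DifferentiableAt.differentiableWithinAt
  unfold mob mobNum
  have := hi z
  fun_prop (disch := assumption)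

/-- the numerator is affine -/
lemma mobNum_affine (a : E) (c : ℂ) (x y z : E) :
    mobNum a (c • (x - y) + z) = c • (mobNum a x - mobNum a y) + mobNum a z := by
  unfold mobNum
  simp only [inner_add_right, inner_smul_right, inner_sub_right]
  module

end mobius

section aut
variable {ι : Type} [Fintype ι]

lemma isBallAut_mob {a : EuclideanSpace ℂ ι} (ha : ‖a‖ < 1) : IsBallAut (mob a) := by
  refine ⟨mob_diff ha, ?_, mob a, mob_diff ha, ?_, ?_, ?_⟩
  · intro z hz; simpa using mob_mem ha (by simpa using hz)
  · intro z hz; simpa using mob_mem ha (by simpa using hz)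
  · intro z hz; exact mob_mob ha (by simpa using hz)
  · intro z hz; exact mob_mob ha (by simpa using hz)

lemma isBallAut_lin (L : EuclideanSpace ℂ ι ≃ₗᵢ[ℂ] EuclideanSpace ℂ ι) : IsBallAut L := by
  refine ⟨L.differentiable.differentiableOn, ?_, L.symm,
    L.symm.differentiable.differentiableOn, ?_, ?_, ?_⟩
  · intro z hz; simpa using hz
  · intro z hz; simpa using hz
  · intro z _; simp
  · intro z _; simp

lemma IsBallAut.comp {ψ φ : EuclideanSpace ℂ ι → EuclideanSpace ℂ ι}
    (hψ : IsBallAut ψ) (hφ : IsBallAut φ) : IsBallAut (ψ ∘ φ) := by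
  obtain ⟨d1, m1, ψ', d1', m1', l1, r1⟩ := hψ
  obtain ⟨d2, m2, φ', d2', m2', l2, r2⟩ := hφ
  refine ⟨d1.comp d2 m2, m1.comp m2, φ' ∘ ψ', d2'.comp d1' m1', m2'.comp m1', ?_, ?_⟩
  · intro z hz
    simp only [Function.comp_apply]
    rw [l1 _ (m2 hz), l2 _ hz]
  · intro z hz
    simp only [Function.comp_apply]
    rw [r2 _ (m1' hz), r1 _ hz]

lemma fix_zero {χ : EuclideanSpace ℂ ι → EuclideanSpace ℂ ι} (h : IsBallAut χ) (h0 : χ 0 = 0) :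
    ∃ L : EuclideanSpace ℂ ι ≃ₗᵢ[ℂ] EuclideanSpace ℂ ι,
      ∀ z ∈ ball (0 : EuclideanSpace ℂ ι) 1, χ z = L z := by
  obtain ⟨d, m, χ', d', m', l, r⟩ := h
  have z0 : (0 : EuclideanSpace ℂ ι) ∈ ball (0 : EuclideanSpace ℂ ι) 1 := by simp
  have h0' : χ' 0 = 0 := by
    have := l _ z0
    rwa [h0] at this
  have hnorm : ∀ z ∈ ball (0 : EuclideanSpace ℂ ι) 1, ‖χ z‖ = ‖z‖ := by
    intro z hz
    apply le_antisymm
    · exact Complex.norm_le_norm_of_mapsTo_ball d (m.mono_right ball_subset_closedBall) h0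
        (by simpa using hz)
    · have := Complex.norm_le_norm_of_mapsTo_ball d' (m'.mono_right ball_subset_closedBall) h0'
        (z := χ z) (by simpa using m hz)
      rwa [l z hz] at this
  have hd0 : DifferentiableAt ℂ χ 0 := d.differentiableAt (ball_mem_nhds _ one_pos)
  set D := fderiv ℂ χ 0 with hD
  -- on each line
  have key : ∀ u : EuclideanSpace ℂ ι, ‖u‖ = 1 → ∀ t : ℂ, ‖t‖ < 1 → χ (t • u) = t • D u := by
    intro u hu t ht
    have hm : MapsTo (fun t : ℂ => t • u) (ball (0 : ℂ) 1) (ball 0 1) := by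
      intro t ht
      simpa [norm_smul, hu] using ht
    have hmm : MapsTo (fun t : ℂ => χ (t • u)) (ball (0 : ℂ) 1)
        (closedBall ((fun t : ℂ => χ (t • u)) 0) 1) := by
      intro t ht
      simp only [zero_smul, h0]
      exact ball_subset_closedBall (m (hm ht))
    have hdd : DifferentiableOn ℂ (fun t : ℂ => χ (t • u)) (ball (0 : ℂ) 1) :=
      d.comp (by fun_prop) hm
    have hhalf : (1 / 2 : ℂ) ∈ ball (0 : ℂ) 1 := by
      simp; norm_num
    have hsl : ‖dslope (fun t : ℂ => χ (t • u)) 0 (1 / 2)‖ = 1 / 1 := by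
      rw [dslope_of_ne _ (by norm_num), slope_def_module]
      have := hnorm _ (hm hhalf)
      simp only [zero_smul, h0, sub_zero, norm_smul] at this ⊢
      rw [this, hu]
      norm_num
    obtain ⟨C, -, hC⟩ := Complex.affine_of_mapsTo_ball_of_exists_norm_dslope_eq_div' hdd hmm
      ⟨_, hhalf, hsl⟩
    have hC' : ∀ s ∈ ball (0 : ℂ) 1, χ (s • u) = s • C := by
      intro s hs
      have := hC hs
      simpa [h0] using this
    have e1 : HasDerivAt (fun t : ℂ => χ (t • u)) (D u) 0 := by
      have hl : HasDerivAt (fun t : ℂ => t • u) u 0 := by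
        simpa using (hasDerivAt_id (0 : ℂ)).smul_const u
      have hf : HasFDerivAt χ D ((fun t : ℂ => t • u) 0) := by
        simpa using hd0.hasFDerivAt
      exact hf.comp_hasDerivAt (0 : ℂ) hl
    have e2 : HasDerivAt (fun t : ℂ => χ (t • u)) C 0 := by
      have hl : HasDerivAt (fun t : ℂ => t • C) C 0 := by
        simpa using (hasDerivAt_id (0 : ℂ)).smul_const C
      apply hl.congr_of_eventuallyEq
      filter_upwards [ball_mem_nhds (0 : ℂ) one_pos] with s hs using hC' s hs
    rw [e1.unique e2]
    exact hC' t (by simpa using ht)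
  have hlin : ∀ z ∈ ball (0 : EuclideanSpace ℂ ι) 1, χ z = D z := by
    intro z hz
    by_cases hz0 : z = 0
    · simp [hz0, h0]
    have hn : ‖z‖ ≠ 0 := norm_ne_zero_iff.2 hz0
    have hnc : (‖z‖ : ℂ) ≠ 0 := by exact_mod_cast hn
    have := key (((‖z‖ : ℂ)⁻¹) • z) (by simp [norm_smul, hn]) (‖z‖ : ℂ) (by simpa using hz)
    rwa [map_smul, smul_smul, smul_smul, mul_inv_cancel₀ hnc, one_smul, one_smul] at this
  have hDn : ∀ z, ‖D z‖ = ‖z‖ := by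
    intro z
    have hp : 0 < 1 + ‖z‖ := by positivity
    have hpc : ((1 + ‖z‖ : ℝ) : ℂ) ≠ 0 := by exact_mod_cast hp.ne'
    have hb : (((1 + ‖z‖ : ℝ) : ℂ)⁻¹ • z) ∈ ball (0 : EuclideanSpace ℂ ι) 1 := by
      rw [mem_ball_zero_iff, norm_smul, norm_inv, Complex.norm_real, Real.norm_of_nonneg hp.le,
        inv_mul_lt_iff₀ hp]
      linarith
    have := hnorm _ hb
    rw [hlin _ hb, map_smul, norm_smul, norm_smul] at this
    exact mul_left_cancel₀ (norm_ne_zero_iff.2 (inv_ne_zero hpc)) this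
  let L0 : EuclideanSpace ℂ ι →ₗᵢ[ℂ] EuclideanSpace ℂ ι := ⟨D.toLinearMap, hDn⟩
  exact ⟨L0.toLinearIsometryEquiv rfl, fun z hz => hlin z hz⟩

lemma ball_aut_structure {ψ : EuclideanSpace ℂ ι → EuclideanSpace ℂ ι} (h : IsBallAut ψ) :
    ∃ a : EuclideanSpace ℂ ι, ‖a‖ < 1 ∧ ∃ L : EuclideanSpace ℂ ι ≃ₗᵢ[ℂ] EuclideanSpace ℂ ι,
      ∀ z ∈ ball (0 : EuclideanSpace ℂ ι) 1, ψ z = L (mob a z) := by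
  obtain ⟨d, m, φ, d', m', l, r⟩ := id h
  have z0 : (0 : EuclideanSpace ℂ ι) ∈ ball (0 : EuclideanSpace ℂ ι) 1 := by simp
  have ha : ‖φ 0‖ < 1 := by simpa using m' z0
  obtain ⟨L, hL⟩ := fix_zero (h.comp (isBallAut_mob ha)) (by
    simp only [Function.comp_apply, mob_zero]; exact r _ z0)
  refine ⟨φ 0, ha, L, fun z hz => ?_⟩
  have hz' : ‖z‖ < 1 := by simpa using hz
  have := hL (mob (φ 0) z) (by simpa using mob_mem ha hz')
  simpa [mob_mob ha hz'] using this

end aut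

section emb
variable {m k : ℕ}

/-- inclusion `w ↦ (0, w)` -/
def inc (m k : ℕ) : EuclideanSpace ℂ (Fin m) →ₗ[ℂ] EuclideanSpace ℂ (Fin k ⊕ Fin m) where
  toFun w := WithLp.toLp 2 (Sum.elim (fun _ => (0 : ℂ)) (fun j => w j))
  map_add' x y := by ext (i | i) <;> simp
  map_smul' c x := by ext (i | i) <;> simp

/-- projection to the last `m` coordinates -/
def prj (m k : ℕ) : EuclideanSpace ℂ (Fin k ⊕ Fin m) →ₗ[ℂ] EuclideanSpace ℂ (Fin m) where
  toFun w := WithLp.toLp 2 (fun j => w (Sum.inr j))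
  map_add' x y := by ext i; simp
  map_smul' c x := by ext i; simp

@[simp] lemma inc_inl (w : EuclideanSpace ℂ (Fin m)) (i : Fin k) : inc m k w (Sum.inl i) = 0 := rfl
@[simp] lemma inc_inr (w : EuclideanSpace ℂ (Fin m)) (i : Fin m) :
    inc m k w (Sum.inr i) = w i := rfl
@[simp] lemma prj_apply (w : EuclideanSpace ℂ (Fin k ⊕ Fin m)) (i : Fin m) :
    prj m k w i = w (Sum.inr i) := rfl
@[simp] lemma prj_inc (w : EuclideanSpace ℂ (Fin m)) : prj m k (inc m k w) = w := by
  ext i; simp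

lemma inc_prj {w : EuclideanSpace ℂ (Fin k ⊕ Fin m)} (h : ∀ i, w (Sum.inl i) = 0) :
    inc m k (prj m k w) = w := by
  ext (i | i) <;> simp [h]

lemma norm_sq_split (w : EuclideanSpace ℂ (Fin k ⊕ Fin m)) :
    ‖w‖ ^ 2 = (∑ i : Fin k, ‖w (Sum.inl i)‖ ^ 2) + ‖prj m k w‖ ^ 2 := by
  simp [EuclideanSpace.norm_sq_eq, Fintype.sum_sum_type]

lemma norm_inc (w : EuclideanSpace ℂ (Fin m)) : ‖inc m k w‖ = ‖w‖ := by
  have := norm_sq_split (inc m k w)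
  simp at this
  exact this

lemma norm_prj_le (w : EuclideanSpace ℂ (Fin k ⊕ Fin m)) : ‖prj m k w‖ ≤ ‖w‖ := by
  have := norm_sq_split w
  have h : 0 ≤ ∑ i : Fin k, ‖w (Sum.inl i)‖ ^ 2 := by positivity
  apply (sq_le_sq₀ (norm_nonneg _) (norm_nonneg _)).1
  linarith

lemma inner_inc (a b : EuclideanSpace ℂ (Fin m)) :
    inner ℂ (inc m k a) (inc m k b) = inner ℂ a b := by
  simp [PiLp.inner_apply, Fintype.sum_sum_type]

lemma mob_inc (a z : EuclideanSpace ℂ (Fin m)) :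
    mob (inc m k a) (inc m k z) = inc m k (mob a z) := by
  simp only [mob, mobNum, mobS, inner_inc, norm_inc, map_smul, map_sub]

/-- `1 ⊕ L` -/
def extL (k : ℕ) (L : EuclideanSpace ℂ (Fin m) ≃ₗᵢ[ℂ] EuclideanSpace ℂ (Fin m)) :
    EuclideanSpace ℂ (Fin k ⊕ Fin m) →ₗᵢ[ℂ] EuclideanSpace ℂ (Fin k ⊕ Fin m) where
  toLinearMap := LinearMap.id +
    (inc m k) ∘ₗ (L.toLinearEquiv.toLinearMap - LinearMap.id) ∘ₗ (prj m k)
  norm_map' w := by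
    have h := norm_sq_split (((LinearMap.id +
      (inc m k) ∘ₗ (L.toLinearEquiv.toLinearMap - LinearMap.id) ∘ₗ (prj m k)) :
      EuclideanSpace ℂ (Fin k ⊕ Fin m) →ₗ[ℂ] EuclideanSpace ℂ (Fin k ⊕ Fin m)) w)
    have h2 := norm_sq_split w
    simp at h
    rw [← h2] at h
    have h3 := (sq_eq_sq₀ (norm_nonneg _) (norm_nonneg _)).1 h
    simpa using h3

lemma extL_inc (L : EuclideanSpace ℂ (Fin m) ≃ₗᵢ[ℂ] EuclideanSpace ℂ (Fin m))
    (w : EuclideanSpace ℂ (Fin m)) : extL k L (inc m k w) = inc m k (L w) := by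
  show inc m k w + inc m k (L (prj m k (inc m k w)) - prj m k (inc m k w)) = _
  simp

lemma key_van {S : Set (EuclideanSpace ℂ (Fin m))}
    (hmin : ∀ s : AffineSubspace ℂ (EuclideanSpace ℂ (Fin m)), (∀ w ∈ S, w ∈ s) → s = ⊤)
    (hS : S ⊆ ball 0 1)
    {ψ : EuclideanSpace ℂ (Fin k ⊕ Fin m) → EuclideanSpace ℂ (Fin k ⊕ Fin m)}
    (h : IsBallAut ψ) (i : Fin k) (h0 : ∀ w ∈ S, ψ (inc m k w) (Sum.inl i) = 0) :
    ∀ w ∈ ball (0 : EuclideanSpace ℂ (Fin m)) 1, ψ (inc m k w) (Sum.inl i) = 0 := by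
  obtain ⟨a, ha, L, hL⟩ := ball_aut_structure h
  have hb : ∀ w ∈ ball (0 : EuclideanSpace ℂ (Fin m)) 1, inc m k w ∈ ball 0 1 := by
    intro w hw
    simpa [norm_inc] using hw
  have hiff : ∀ w ∈ ball (0 : EuclideanSpace ℂ (Fin m)) 1,
      (ψ (inc m k w) (Sum.inl i) = 0 ↔ L (mobNum a (inc m k w)) (Sum.inl i) = 0) := by
    intro w hw
    have hw' : ‖inc m k w‖ < 1 := by simpa using hb w hw
    rw [hL _ (hb w hw), mob, map_smul]
    simp [one_sub_inner_ne ha hw']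
  let s : AffineSubspace ℂ (EuclideanSpace ℂ (Fin m)) :=
    { carrier := {w | L (mobNum a (inc m k w)) (Sum.inl i) = 0}
      smul_vsub_vadd_mem' := by
        intro c x y z hx hy hz
        simp only [mem_setOf_eq, vsub_eq_sub, vadd_eq_add] at *
        rw [map_add, map_smul, map_sub, mobNum_affine, map_add, map_smul, map_sub]
        simp [hx, hy, hz] }
  have hs : s = ⊤ := hmin s (fun w hw => (hiff w (hS hw)).1 (h0 w hw))
  intro w hw
  rw [hiff w hw]
  have : w ∈ s := by rw [hs]; trivial
  exact this

end emb

/-- for minimal holomorphic `f : 𝔹ⁿ → 𝔹ᵐ` with `f 0 = 0` and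
`g = 0 ⊕ f : 𝔹ⁿ → 𝔹ᴺ` (`N = k + m`, `k ≥ 1`, modeled by the index type `Fin k ⊕ Fin m`),
one has `Γ_f = Γ_g`. -/
theorem stmt11 {n m k : ℕ} (hk : 1 ≤ k)
    (f : EuclideanSpace ℂ (Fin n) → EuclideanSpace ℂ (Fin m))
    (hf : DifferentiableOn ℂ f (ball (0 : EuclideanSpace ℂ (Fin n)) 1))
    (hfm : MapsTo f (ball (0 : EuclideanSpace ℂ (Fin n)) 1) (ball (0 : EuclideanSpace ℂ (Fin m)) 1))
    (hf0 : f 0 = 0)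
    (hmin : ∀ s : AffineSubspace ℂ (EuclideanSpace ℂ (Fin m)),
      (∀ z ∈ ball (0 : EuclideanSpace ℂ (Fin n)) 1, f z ∈ s) → s = ⊤)
    (g : EuclideanSpace ℂ (Fin n) → EuclideanSpace ℂ (Fin k ⊕ Fin m))
    (hg : ∀ z, g z = (Sum.elim (fun _ => (0 : ℂ)) (fun j => f z j) : Fin k ⊕ Fin m → ℂ)) :
    ∀ γ : EuclideanSpace ℂ (Fin n) → EuclideanSpace ℂ (Fin n), IsBallAut γ →
      ((∃ ψ : EuclideanSpace ℂ (Fin m) → EuclideanSpace ℂ (Fin m), IsBallAut ψ ∧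
          ∀ z ∈ ball (0 : EuclideanSpace ℂ (Fin n)) 1, f (γ z) = ψ (f z)) ↔
        (∃ ψ' : EuclideanSpace ℂ (Fin k ⊕ Fin m) → EuclideanSpace ℂ (Fin k ⊕ Fin m),
          IsBallAut ψ' ∧ ∀ z ∈ ball (0 : EuclideanSpace ℂ (Fin n)) 1, g (γ z) = ψ' (g z))) := by
  intro γ hγ
  have hgi : ∀ z, g z = inc m k (f z) := by
    intro z
    ext i
    rw [hg z]
    rcases i with i | i <;> simp
  have hib : ∀ w ∈ ball (0 : EuclideanSpace ℂ (Fin m)) 1,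
      inc m k w ∈ ball (0 : EuclideanSpace ℂ (Fin k ⊕ Fin m)) 1 := by
    intro w hw
    simpa [norm_inc] using hw
  have hpb : ∀ w ∈ ball (0 : EuclideanSpace ℂ (Fin k ⊕ Fin m)) 1,
      prj m k w ∈ ball (0 : EuclideanSpace ℂ (Fin m)) 1 := by
    intro w hw
    have : ‖w‖ < 1 := by simpa using hw
    simpa using (norm_prj_le w).trans_lt this
  constructor
  · rintro ⟨ψ, hψ, he⟩
    obtain ⟨a, ha, L, hL⟩ := ball_aut_structure hψ
    refine ⟨_, (isBallAut_lin ((extL k L).toLinearIsometryEquiv rfl)).comp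
      (isBallAut_mob (a := inc m k a) (by rwa [norm_inc])), ?_⟩
    intro z hz
    rw [hgi, hgi, he z hz, hL _ (hfm hz)]
    show _ = extL k L (mob (inc m k a) (inc m k (f z)))
    rw [mob_inc, extL_inc]
  · rintro ⟨ψ, hψ, he⟩
    obtain ⟨d, mm, φ, d', mm', l, r⟩ := id hψ
    have hφ : IsBallAut φ := ⟨d', mm', ψ, d, mm, r, l⟩
    have hS : f '' ball (0 : EuclideanSpace ℂ (Fin n)) 1 ⊆ ball 0 1 := hfm.image_subset
    have hmin' : ∀ s : AffineSubspace ℂ (EuclideanSpace ℂ (Fin m)),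
        (∀ w ∈ f '' ball (0 : EuclideanSpace ℂ (Fin n)) 1, w ∈ s) → s = ⊤ :=
      fun s hs => hmin s (fun z hz => hs _ ⟨z, hz, rfl⟩)
    obtain ⟨-, γm, δ, -, δm, -, γr⟩ := hγ
    have e1 : ∀ i : Fin k, ∀ w ∈ ball (0 : EuclideanSpace ℂ (Fin m)) 1,
        ψ (inc m k w) (Sum.inl i) = 0 := by
      intro i
      apply key_van hmin' hS hψ i
      rintro _ ⟨z, hz, rfl⟩
      rw [← hgi, ← he z hz, hgi, inc_inl]
    have e2 : ∀ i : Fin k, ∀ w ∈ ball (0 : EuclideanSpace ℂ (Fin m)) 1,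
        φ (inc m k w) (Sum.inl i) = 0 := by
      intro i
      apply key_van hmin' hS hφ i
      rintro _ ⟨z, hz, rfl⟩
      have h1 := he (δ z) (δm hz)
      rw [γr z hz, hgi, hgi] at h1
      rw [h1, l _ (hib _ (hfm (δm hz))), inc_inl]
    have di : Differentiable ℂ (inc m k) := (inc m k).toContinuousLinearMap.differentiable
    have dp : Differentiable ℂ (prj m k) := (prj m k).toContinuousLinearMap.differentiable
    refine ⟨fun w => prj m k (ψ (inc m k w)), ⟨?_, ?_, fun w => prj m k (φ (inc m k w)),
      ?_, ?_, ?_, ?_⟩, ?_⟩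
    · exact dp.comp_differentiableOn (d.comp di.differentiableOn hib)
    · intro w hw; exact hpb _ (mm (hib w hw))
    · exact dp.comp_differentiableOn (d'.comp di.differentiableOn hib)
    · intro w hw; exact hpb _ (mm' (hib w hw))
    · intro w hw
      simp only []
      rw [inc_prj (fun i => e1 i w hw), l _ (hib w hw), prj_inc]
    · intro w hw
      simp only []
      rw [inc_prj (fun i => e2 i w hw), r _ (hib w hw), prj_inc]
    · intro z hz
      simp only []
      rw [← hgi, ← he z hz, hgi, prj_inc]
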